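/- arXiv:math/0004175 — 2 statements merged into one kernel-verified Lean document; each statement's English description precedes it below -/
import Mathlib

section
/- Let r_1,…,r_m be positive reals with R = ∑_i r_i, and let I' be a proper subset of {1,…,m} of size t. Then ∑_{orderings (π_1,…,π_t) of I'} ∏_{i=1}^{t} r_{π_i}/(R − ∑_{j=1}^{i−1} r_{π_j}) = ∑_{I ⊆ I'} (−1)^{|I'|−|I|} (∑_{i∉I'} r_i)/(∑_{i∉I} r_i). -/
/-- `Pr(r, (i_1, …, i_t))`: the urn probability
`∏_{s=1}^{t} r_{i_s} / (R − ∑_{u<s} r_{i_u})` for a sequence `ι` of (distinct) indices. -/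
noncomputable def prSeq {m t : ℕ} (r : Fin m → ℝ) (ι : Fin t → Fin m) : ℝ :=
  ∏ s : Fin t,
    r (ι s) / ((∑ i, r i) - ∑ u ∈ Finset.univ.filter fun u => u < s, r (ι u))

open Finset in
/-- Inverse-of-complement alternating sums over subsets satisfy a recursion on deleting a point. -/
theorem sum_mul_alternating_sum_powerset_erase {α K : Type*} [DecidableEq α] [Field K]
    (r : α → K) (R : K) (S : Finset α) (hS : S.Nonempty)
    (hR : ∀ I ⊆ S, R - ∑ i ∈ I, r i ≠ 0) :
    ∑ x ∈ S, r x * ∑ I ∈ (S.erase x).powerset,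
        (-1 : K) ^ (#(S.erase x) - #I) / (R - ∑ i ∈ I, r i)
      = (R - ∑ i ∈ S, r i) *
        ∑ I ∈ S.powerset, (-1 : K) ^ (#S - #I) / (R - ∑ i ∈ I, r i) := by
  have hsign : ∑ I ∈ S.powerset, (-1 : K) ^ (#S - #I) = 0 := by
    have hsum : ∑ I ∈ S.powerset, (-1 : K) ^ #I = 0 := by
      exact_mod_cast congrArg (Int.cast : ℤ → K) (sum_powerset_neg_one_pow_card_of_nonempty hS)
    calc ∑ I ∈ S.powerset, (-1 : K) ^ (#S - #I)
        = ∑ I ∈ S.powerset, (-1 : K) ^ #S * (-1 : K) ^ #I := by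
          refine sum_congr rfl fun I hI => ?_
          have hle := card_le_card (mem_powerset.mp hI)
          rw [← pow_add, neg_one_pow_congr]
          grind
      _ = 0 := by rw [← mul_sum, hsum, mul_zero]
  calc _ = ∑ x ∈ S, ∑ I ∈ (S.erase x).powerset,
        r x * ((-1 : K) ^ (#S - 1 - #I) / (R - ∑ i ∈ I, r i)) := by
        refine sum_congr rfl fun x hx => ?_
        rw [mul_sum, card_erase_of_mem hx]
    _ = ∑ I ∈ S.powerset, ∑ x ∈ S \ I,
        r x * ((-1 : K) ^ (#S - 1 - #I) / (R - ∑ i ∈ I, r i)) := by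
        refine sum_comm' fun x I => ?_
        simp only [mem_powerset, mem_sdiff, subset_erase]
        tauto
    _ = ∑ I ∈ S.powerset, ((R - ∑ i ∈ S, r i) * ((-1 : K) ^ (#S - #I) / (R - ∑ i ∈ I, r i))
        - (-1 : K) ^ (#S - #I)) := by
        refine sum_congr rfl fun I hI => ?_
        have hIS := mem_powerset.mp hI
        have h0 := hR I hIS
        have hdiff := sum_sdiff (f := r) hIS
        rw [← sum_mul]
        rcases hIS.eq_or_ssubset with rfl | hlt
        · simp [h0]
        · have hcard := card_lt_card hlt
          have hpow : #S - #I = (#S - 1 - #I) + 1 := by omega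
          rw [hpow, pow_succ, ← hdiff]
          field_simp
          ring
    _ = _ := by rw [sum_sub_distrib, hsign, sub_zero, mul_sum]

/-- The urn probability of a sequence, split off at its last draw. -/
theorem prSeq_snoc {m t : ℕ} (r : Fin m → ℝ) (ι : Fin t → Fin m) (x : Fin m) :
    prSeq r (Fin.snoc ι x : Fin (t + 1) → Fin m)
      = prSeq r ι * (r x / ((∑ i, r i) - ∑ u, r (ι u))) := by
  have hfilter : ∀ s : Fin (t + 1), ∑ u ∈ Finset.univ.filter (fun u => u < s),
      r ((Fin.snoc ι x : Fin (t + 1) → Fin m) u)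
        = ∑ u : Fin t, if u.castSucc < s then r (ι u) else 0 := by
    intro s
    rw [Finset.sum_filter, Fin.sum_univ_castSucc]
    simp [(Fin.le_last s).not_gt]
  simp only [prSeq, hfilter]
  rw [Fin.prod_univ_castSucc]
  simp [Finset.sum_filter, Fin.castSucc_lt_last]

/-- An enumeration of `S` is an enumeration of `S.erase x` followed by some `x ∈ S`. -/
theorem snoc_injective_and_image_eq_iff {α : Type*} [DecidableEq α] {t : ℕ}
    (ι : Fin t → α) (x : α) (S : Finset α) :
    (Function.Injective (Fin.snoc ι x : Fin (t + 1) → α) ∧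
        Finset.univ.image (Fin.snoc ι x : Fin (t + 1) → α) = S) ↔
      x ∈ S ∧ Function.Injective ι ∧ Finset.univ.image ι = S.erase x := by
  have himage : Finset.univ.image (Fin.snoc ι x : Fin (t + 1) → α)
      = insert x (Finset.univ.image ι) := by
    ext y
    simp [Fin.exists_iff_castSucc, eq_comm]
  have hx : x ∉ Set.range ι ↔ x ∉ Finset.univ.image ι := by simp
  rw [Fin.snoc_injective_iff, himage, hx]
  constructor
  · rintro ⟨⟨hι, hx⟩, rfl⟩
    exact ⟨Finset.mem_insert_self _ _, hι, (Finset.erase_insert hx).symm⟩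
  · rintro ⟨hxS, hι, h⟩
    rw [h]
    exact ⟨⟨hι, Finset.notMem_erase _ _⟩, Finset.insert_erase hxS⟩

/-- The probability of drawing exactly `S` first, by conditioning on the last ball of `S` drawn. -/
theorem sum_prSeq_succ {m t : ℕ} (r : Fin m → ℝ) (S : Finset (Fin m)) :
    (∑ ι : Fin (t + 1) → Fin m,
        if Function.Injective ι ∧ Finset.univ.image ι = S then prSeq r ι else 0)
      = ∑ x ∈ S, (∑ ι : Fin t → Fin m,
          if Function.Injective ι ∧ Finset.univ.image ι = S.erase x then prSeq r ι else 0)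
            * (r x / ((∑ i, r i) - ∑ i ∈ S.erase x, r i)) := by
  have hsnoc : ∀ (x : Fin m) (ι : Fin t → Fin m),
      Fin.snocEquiv (fun _ => Fin m) (x, ι) = Fin.snoc ι x := fun _ _ => rfl
  rw [← (Fin.snocEquiv fun _ => Fin m).sum_comp, Fintype.sum_prod_type,
    ← Finset.sum_subset (Finset.subset_univ S)]
  · refine Finset.sum_congr rfl fun x hx => ?_
    rw [Finset.sum_mul]
    refine Finset.sum_congr rfl fun ι _ => ?_
    simp only [hsnoc, snoc_injective_and_image_eq_iff, hx, true_and]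
    split_ifs with h
    · rw [prSeq_snoc, ← h.2, Finset.sum_image h.1.injOn]
    · rw [zero_mul]
  · intro x _ hx
    refine Finset.sum_eq_zero fun ι _ => ?_
    simp only [hsnoc, snoc_injective_and_image_eq_iff, hx, false_and, if_false]

/-- Inclusion–exclusion formula for the urn probability: the probability that the first
`t` balls drawn are exactly those of the proper subset `I'` (the sum over all orderings
`(π_1,…,π_t)` of `I'` of `∏_i r_{π_i}/(R − ∑_{j<i} r_{π_j})`) equals
`∑_{I ⊆ I'} (−1)^{|I'|−|I|} (∑_{i∉I'} r i)/(∑_{i∉I} r i)`. -/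
theorem urn_inclusion_exclusion (m t : ℕ) (r : Fin m → ℝ) (hr : ∀ i, 0 < r i)
    (I' : Finset (Fin m)) (hproper : I' ≠ Finset.univ) (hcard : I'.card = t) :
    (∑ ι : Fin t → Fin m,
        if Function.Injective ι ∧ Finset.univ.image ι = I' then prSeq r ι else 0)
      = ∑ I ∈ I'.powerset,
          (-1 : ℝ) ^ (I'.card - I.card) * (∑ i ∈ I'ᶜ, r i) / (∑ i ∈ Iᶜ, r i) := by
  have hcompl : ∀ I : Finset (Fin m), ∑ i ∈ Iᶜ, r i = (∑ i, r i) - ∑ i ∈ I, r i := fun I =>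
    eq_sub_of_add_eq (Finset.sum_compl_add_sum I r)
  have hne : ∀ I : Finset (Fin m), I ≠ Finset.univ → (∑ i, r i) - ∑ i ∈ I, r i ≠ 0 := by
    intro I hI
    rw [← hcompl]
    refine (Finset.sum_pos (fun i _ => hr i) ?_).ne'
    rwa [← Finset.compl_ne_univ_iff_nonempty, compl_compl]
  simp only [hcompl, mul_right_comm _ _ (_⁻¹), div_eq_mul_inv]
  rw [← Finset.sum_mul]
  induction t generalizing I' with
  | zero =>
    obtain rfl := Finset.card_eq_zero.mp hcard
    have h0 := hne ∅ hproper
    simp only [Finset.sum_empty, sub_zero] at h0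
    simp [prSeq, h0, Function.injective_of_subsingleton]
  | succ t ih =>
    have hsub : ∀ I ⊆ I', I ≠ Finset.univ := fun I hI h =>
      hproper (Finset.univ_subset_iff.mp (h ▸ hI))
    have hrec := sum_mul_alternating_sum_powerset_erase r (∑ i, r i) I'
      (Finset.card_pos.mp (by omega)) fun I hI => hne I (hsub I hI)
    simp only [div_eq_mul_inv] at hrec
    rw [sum_prSeq_succ, mul_comm, ← hrec]
    refine Finset.sum_congr rfl fun x hx => ?_
    have hx' := hsub _ (Finset.erase_subset x I')
    rw [ih _ hx' (by rw [Finset.card_erase_of_mem hx, hcard, Nat.add_sub_cancel])]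
    have := hne _ hx'
    field_simp
end

section
/- Let k ≤ m ≤ n and 1 ≤ l ≤ m with k ≤ m − l. For positive reals r_1,…,r_m and c_1,…,c_n, the limit of E(k,r_1,…,r_m,c_1,…,c_n) as r_1,…,r_l all tend to 0 from above equals E(k,r_{l+1},…,r_m,c_1,…,c_n). -/
open MeasureTheory Filter

/-- A `k`-assignment of an `m × n` matrix: a set of `k` positions,
no two in the same row or column. -/
def IsAssignF (m n k : ℕ) (S : Finset (Fin m × Fin n)) : Prop :=
  S.card = k ∧ ∀ p ∈ S, ∀ q ∈ S, p ≠ q → p.1 ≠ q.1 ∧ p.2 ≠ q.2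

/-- The value `min_k(x)` of a minimum `k`-assignment of the matrix `x`. -/
noncomputable def minAssign (m n k : ℕ) (x : Fin m × Fin n → ℝ) : ℝ :=
  sInf {v | ∃ S : Finset (Fin m × Fin n), IsAssignF m n k S ∧ v = ∑ p ∈ S, x p}

/-- The law of a random exponential `m × n` matrix whose entry `(i,j)` has rate
`r i * c j` (rates indexed by naturals, rows `0,…,m−1` and columns `0,…,n−1`):
the measure on `(Fin m × Fin n) → ℝ` with the product exponential density with
respect to Lebesgue measure. -/
noncomputable def rankOneMeasure (m n : ℕ) (r c : ℕ → ℝ) :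
    Measure ((Fin m × Fin n) → ℝ) :=
  volume.withDensity fun x => ENNReal.ofReal
    (∏ p : Fin m × Fin n,
      if 0 ≤ x p then (r p.1.val * c p.2.val) * Real.exp (-((r p.1.val * c p.2.val) * x p))
      else 0)

/-- `E(k, r₀…r_{m−1}, c₀…c_{n−1})`: the expected value of the minimum `k`-assignment of a
random exponential `m × n` matrix with rank 1 rate matrix `(r i * c j)`. -/
noncomputable def Emin (k m n : ℕ) (r c : ℕ → ℝ) : ℝ :=
  ∫ x, minAssign m n k x ∂(rankOneMeasure m n r c)

open ProbabilityTheory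

theorem isAssignF_iff_image {m n k : ℕ} {S : Finset (Fin m × Fin n)} {m' : ℕ}
    {f : Fin m' → Fin m} (hf : Function.Injective f) {T : Finset (Fin m' × Fin n)}
    (hS : S = T.map ⟨Prod.map f id, hf.prodMap Function.injective_id⟩) :
    IsAssignF m n k S ↔ IsAssignF m' n k T := by
  subst hS
  simp only [IsAssignF, Finset.card_map, Finset.mem_map, Function.Embedding.coeFn_mk,
    forall_exists_index, and_imp, forall_apply_eq_imp_iff₂, Prod.map_fst, Prod.map_snd, id,
    ne_eq, hf.eq_iff, (hf.prodMap Function.injective_id).eq_iff]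

theorem exists_isAssignF {m n k : ℕ} (hm : k ≤ m) (hn : k ≤ n) :
    ∃ S : Finset (Fin m × Fin n), IsAssignF m n k S := by
  refine ⟨Finset.univ.map ⟨fun i : Fin k => (Fin.castLE hm i, Fin.castLE hn i), ?_⟩, ?_, ?_⟩
  · intro i j h
    exact Fin.castLE_injective hm (Prod.ext_iff.1 h).1
  · simp
  · simp only [Finset.mem_map, Finset.mem_univ, true_and]
    rintro _ ⟨i, rfl⟩ _ ⟨j, rfl⟩ h
    have hij : i ≠ j := by rintro rfl; exact h rfl
    exact ⟨fun e => hij (Fin.castLE_injective hm e), fun e => hij (Fin.castLE_injective hn e)⟩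

theorem finite_assign_values (m n k : ℕ) (x : Fin m × Fin n → ℝ) :
    {v | ∃ S : Finset (Fin m × Fin n), IsAssignF m n k S ∧ v = ∑ p ∈ S, x p}.Finite :=
  (Set.finite_range fun S : Finset (Fin m × Fin n) => ∑ p ∈ S, x p).subset
    fun _ ⟨S, _, h⟩ => ⟨S, h.symm⟩

theorem minAssign_le {m n k : ℕ} {x : Fin m × Fin n → ℝ} {S : Finset (Fin m × Fin n)}
    (hS : IsAssignF m n k S) : minAssign m n k x ≤ ∑ p ∈ S, x p :=
  csInf_le (finite_assign_values m n k x).bddBelow ⟨S, hS, rfl⟩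

theorem le_minAssign {m n k : ℕ} (hm : k ≤ m) (hn : k ≤ n) {x : Fin m × Fin n → ℝ} {a : ℝ}
    (h : ∀ S, IsAssignF m n k S → a ≤ ∑ p ∈ S, x p) : a ≤ minAssign m n k x := by
  obtain ⟨S, hS⟩ := exists_isAssignF hm hn
  refine le_csInf ⟨_, S, hS, rfl⟩ ?_
  rintro _ ⟨T, hT, rfl⟩
  exact h T hT

theorem measurable_minAssign (m n k : ℕ) : Measurable (minAssign m n k) := by
  have h : minAssign m n k =
      fun x => ⨅ S : {S : Finset (Fin m × Fin n) // IsAssignF m n k S}, ∑ p ∈ S.1, x p := by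
    funext x
    rw [minAssign, iInf]
    congr 1
    ext v
    simp [eq_comm]
  rw [h]
  exact Measurable.iInf fun S => Finset.measurable_sum _ fun p _ => measurable_pi_apply p

theorem minAssign_le_comp {m m' n k : ℕ} (hm : k ≤ m') (hn : k ≤ n) {f : Fin m' → Fin m}
    (hf : Function.Injective f) (x : Fin m × Fin n → ℝ) :
    minAssign m n k x ≤ minAssign m' n k (x ∘ Prod.map f id) := by
  refine le_minAssign hm hn fun T hT => ?_
  refine (minAssign_le ((isAssignF_iff_image hf rfl).2 hT)).trans_eq ?_
  simp

theorem minAssign_eq_comp {m m' n k : ℕ} (hm : k ≤ m') (hm' : m' ≤ m) (hn : k ≤ n)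
    {f : Fin m' → Fin m} (hf : Function.Injective f) {x : Fin m × Fin n → ℝ} (hx : ∀ p, 0 ≤ x p)
    (hlarge : ∀ p : Fin m × Fin n, p.1 ∉ Set.range f →
      minAssign m' n k (x ∘ Prod.map f id) ≤ x p) :
    minAssign m n k x = minAssign m' n k (x ∘ Prod.map f id) := by
  classical
  refine le_antisymm (minAssign_le_comp hm hn hf x) (le_minAssign (hm.trans hm') hn fun S hS => ?_)
  by_cases h : ∃ p ∈ S, p.1 ∉ Set.range f
  · obtain ⟨p, hp, hpf⟩ := h
    exact (hlarge p hpf).trans (Finset.single_le_sum (fun q _ => hx q) hp)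
  · push Not at h
    set g : Fin m' × Fin n ↪ Fin m × Fin n := ⟨Prod.map f id, hf.prodMap Function.injective_id⟩
    obtain ⟨T, hT⟩ : ∃ T : Finset (Fin m' × Fin n), S = T.map g := by
      refine ⟨Finset.univ.filter fun q => g q ∈ S, ?_⟩
      ext p
      simp only [Finset.mem_map, Finset.mem_filter, Finset.mem_univ, true_and]
      constructor
      · intro hp
        obtain ⟨i, hi⟩ := h p hp
        have : g (i, p.2) = p := Prod.ext hi rfl
        exact ⟨(i, p.2), this.symm ▸ hp, this⟩
      · rintro ⟨q, hq, rfl⟩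
        exact hq
    refine (minAssign_le ((isAssignF_iff_image hf hT).1 hS)).trans_eq ?_
    simp [hT, g]

theorem integrable_exponentialPDFReal {a : ℝ} (ha : 0 < a) :
    Integrable (exponentialPDFReal a) := by
  refine ⟨(measurable_exponentialPDFReal a).aestronglyMeasurable, ?_⟩
  rw [hasFiniteIntegral_iff_ofReal (ae_of_all _ (exponentialPDFReal_nonneg ha))]
  exact (lintegral_exponentialPDF_eq_one ha).trans_lt ENNReal.one_lt_top

theorem withDensity_prod_exponentialPDFReal {ι : Type*} [Fintype ι] {a : ι → ℝ}
    (ha : ∀ i, 0 < a i) :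
    (volume : Measure (ι → ℝ)).withDensity
        (fun x => ENNReal.ofReal (∏ i, exponentialPDFReal (a i) (x i))) =
      Measure.pi fun i => expMeasure (a i) := by
  have := fun i => isProbabilityMeasure_expMeasure (ha i)
  refine (Measure.pi_eq fun s hs => ?_).symm
  have hint : ∀ i, Integrable ((s i).indicator (exponentialPDFReal (a i))) := fun i =>
    (integrable_exponentialPDFReal (ha i)).indicator (hs i)
  have hnn : ∀ i x, 0 ≤ (s i).indicator (exponentialPDFReal (a i)) x := fun i x =>
    Set.indicator_nonneg (fun y _ => exponentialPDFReal_nonneg (ha i) y) x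
  have hone : ∀ i, expMeasure (a i) (s i) =
      ENNReal.ofReal (∫ x, (s i).indicator (exponentialPDFReal (a i)) x) := by
    intro i
    rw [ofReal_integral_eq_lintegral_ofReal (hint i) (ae_of_all _ (hnn i)), expMeasure,
      gammaMeasure, withDensity_apply _ (hs i), ← lintegral_indicator (hs i)]
    refine lintegral_congr fun x => ?_
    by_cases hx : x ∈ s i <;> simp [hx, exponentialPDFReal, gammaPDF]
  simp_rw [hone]
  rw [← ENNReal.ofReal_prod_of_nonneg fun i _ => integral_nonneg (hnn i),
    ← integral_fintype_prod_volume_eq_prod, ofReal_integral_eq_lintegral_ofReal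
      (by rw [volume_pi]; exact Integrable.fintype_prod hint) (ae_of_all _ fun x => Finset.prod_nonneg fun i _ => hnn i _),
    withDensity_apply _ (MeasurableSet.univ_pi hs),
    ← lintegral_indicator (MeasurableSet.univ_pi hs)]
  refine lintegral_congr fun x => ?_
  by_cases hx : x ∈ Set.univ.pi s
  · rw [Set.indicator_of_mem hx]
    congr 1
    exact Finset.prod_congr rfl fun i _ => (Set.indicator_of_mem (hx i trivial) _).symm
  · rw [Set.indicator_of_notMem hx]
    obtain ⟨i, hi⟩ : ∃ i, x i ∉ s i := by simpa [Set.mem_pi] using hx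
    rw [Finset.prod_eq_zero (Finset.mem_univ i) (Set.indicator_of_notMem hi _),
      ENNReal.ofReal_zero]

theorem map_div_expMeasure_one {a : ℝ} (ha : 0 < a) :
    (expMeasure 1).map (fun x => x / a) = expMeasure a := by
  have := isProbabilityMeasure_expMeasure ha
  have := isProbabilityMeasure_expMeasure one_pos
  have hm : Measurable fun x : ℝ => x / a := by fun_prop
  have := Measure.isProbabilityMeasure_map (μ := expMeasure 1) hm.aemeasurable
  refine Measure.eq_of_cdf _ _ ?_
  ext x
  rw [cdf_expMeasure_eq ha, cdf_eq_real, measureReal_def, Measure.map_apply hm measurableSet_Iic]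
  have : (fun x => x / a) ⁻¹' Set.Iic x = Set.Iic (a * x) := by
    ext y
    simp [div_le_iff₀' ha]
  rw [this, ← measureReal_def, ← cdf_eq_real, cdf_expMeasure_eq one_pos]
  simp [ha]

theorem ae_expMeasure_pos {a : ℝ} : ∀ᵐ x ∂expMeasure a, 0 < x := by
  rw [expMeasure, gammaMeasure, ae_withDensity_iff
    (show Measurable (gammaPDF 1 a) from (measurable_gammaPDFReal 1 a).ennreal_ofReal)]
  filter_upwards [Measure.ae_ne volume (0 : ℝ)] with x hx h
  by_contra hneg
  exact h (gammaPDF_of_neg (lt_of_le_of_ne (not_lt.1 hneg) hx))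

theorem integrable_id_expMeasure_one : Integrable id (expMeasure 1) := by
  have hm : Measurable (gammaPDF 1 1) := (measurable_gammaPDFReal 1 1).ennreal_ofReal
  rw [expMeasure, gammaMeasure, integrable_withDensity_iff hm
    (ae_of_all _ fun x => ENNReal.ofReal_lt_top)]
  have h := (Real.GammaIntegral_convergent (s := 2) two_pos).integrable_indicator measurableSet_Ioi
  refine h.congr (ae_of_all _ fun x => ?_)
  change _ = x * (exponentialPDF 1 x).toReal
  rw [exponentialPDF_eq]
  rcases lt_trichotomy x 0 with hx | rfl | hx
  · simp [hx.not_ge, hx.le]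
  · simp
  · norm_num [hx, hx.le, Real.exp_nonneg, mul_comm]

theorem map_comp_pi_const {ι κ : Type*} [Fintype ι] [Fintype κ] {f : κ → ι}
    (hf : Function.Injective f) (μ : Measure ℝ) [IsProbabilityMeasure μ] :
    (Measure.pi fun _ : ι => μ).map (fun x => x ∘ f) = Measure.pi fun _ : κ => μ := by
  have h := (iIndepFun_pi (μ := fun _ : ι => μ) (X := fun _ => id)
    fun _ => aemeasurable_id).precomp hf
  refine ((iIndepFun_iff_map_fun_eq_pi_map
    (fun i => (measurable_pi_apply (f i)).aemeasurable)).1 h).trans ?_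
  congr 1
  funext i
  exact (measurePreserving_eval (fun _ : ι => μ) (f i)).map_eq

theorem rankOneMeasure_eq_map {m n : ℕ} {r c : ℕ → ℝ} (hr : ∀ i < m, 0 < r i)
    (hc : ∀ j < n, 0 < c j) :
    rankOneMeasure m n r c = (Measure.pi fun _ : Fin m × Fin n => expMeasure 1).map
      fun y p => y p / (r p.1 * c p.2) := by
  have ha : ∀ p : Fin m × Fin n, 0 < r p.1 * c p.2 := fun p =>
    mul_pos (hr _ p.1.2) (hc _ p.2.2)
  have := isProbabilityMeasure_expMeasure one_pos
  have := fun p => isProbabilityMeasure_expMeasure (ha p)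
  have h1 : rankOneMeasure m n r c =
      Measure.pi fun p : Fin m × Fin n => expMeasure (r p.1 * c p.2) := by
    rw [← withDensity_prod_exponentialPDFReal ha, rankOneMeasure]
    congr 1
    funext x
    congr 1
    refine Finset.prod_congr rfl fun p _ => ?_
    simp [exponentialPDFReal, gammaPDFReal]
  rw [h1]
  simp_rw [← map_div_expMeasure_one (ha _)]
  have := fun p => Measure.isProbabilityMeasure_map (μ := expMeasure 1)
    (f := fun x => x / (r (p : Fin m × Fin n).1.val * c p.2.val))
    (Measurable.aemeasurable (by fun_prop))
  exact (Measure.pi_map_pi (μ := fun _ : Fin m × Fin n => expMeasure 1)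
    fun p => Measurable.aemeasurable (by fun_prop)).symm

theorem Emin_eq_integral {k m n : ℕ} {r c : ℕ → ℝ} (hr : ∀ i < m, 0 < r i)
    (hc : ∀ j < n, 0 < c j) :
    Emin k m n r c = ∫ y, minAssign m n k (fun p => y p / (r p.1 * c p.2))
      ∂Measure.pi fun _ : Fin m × Fin n => expMeasure 1 := by
  rw [Emin, rankOneMeasure_eq_map hr hc, integral_map (Measurable.aemeasurable (by fun_prop))
    (measurable_minAssign m n k).aestronglyMeasurable]

/-- If `k ≤ m − l`, the limit of `E(k, r₁,…,r_m, c)` as the first `l` rates `r₁,…,r_l`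
tend to `0` from above is `E(k, r_{l+1},…,r_m, c)`. -/
theorem Emin_limit_small_k (k m n l : ℕ) (hk : 0 < k) (hl : 1 ≤ l) (hlm : l ≤ m)
    (hkml : k ≤ m - l) (hmn : m ≤ n)
    (r c : ℕ → ℝ) (hr : ∀ i < m, 0 < r i) (hc : ∀ j < n, 0 < c j) :
    Tendsto
      (fun ρ : Fin l → ℝ =>
        Emin k m n (fun i => if h : i < l then ρ ⟨i, h⟩ else r i) c)
      (nhdsWithin 0 {ρ | ∀ i, 0 < ρ i})
      (nhds (Emin k (m - l) n (fun i => r (i + l)) c)) := by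
  have := isProbabilityMeasure_expMeasure one_pos
  have hkn : k ≤ n := by omega
  have hkm : k ≤ m := by omega
  set f : Fin (m - l) → Fin m := fun i => ⟨i + l, by omega⟩ with hf_def
  have hf : Function.Injective f := by
    intro i j h
    simp only [hf_def, Fin.mk.injEq] at h
    exact Fin.ext (by omega)
  have hrange : ∀ i : Fin m, i ∉ Set.range f → i.val < l := by
    intro i hi
    by_contra h
    exact hi ⟨⟨i - l, by omega⟩, Fin.ext (by simp only [hf_def]; omega)⟩
  set rate : (Fin l → ℝ) → ℕ → ℝ := fun ρ i => if h : i < l then ρ ⟨i, h⟩ else r i with hrate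
  have hrate_pos : ∀ ρ : Fin l → ℝ, (∀ i, 0 < ρ i) → ∀ i < m, 0 < rate ρ i := by
    intro ρ hρ i hi
    simp only [hrate]
    split_ifs
    exacts [hρ _, hr i hi]
  set μ : Measure (Fin m × Fin n → ℝ) := Measure.pi fun _ => expMeasure 1 with hμ
  set x : (Fin l → ℝ) → (Fin m × Fin n → ℝ) → Fin m × Fin n → ℝ :=
    fun ρ y p => y p / (rate ρ p.1 * c p.2) with hx
  set z : (Fin m × Fin n → ℝ) → Fin (m - l) × Fin n → ℝ :=
    fun y q => y (Prod.map f id q) / (r (q.1 + l) * c q.2) with hz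
  have hxz : ∀ ρ y, x ρ y ∘ Prod.map f id = z y := by
    intro ρ y
    funext q
    simp [hx, hz, hrate, hf_def]
  have hx_nn : ∀ ρ : Fin l → ℝ, (∀ i, 0 < ρ i) → ∀ y : Fin m × Fin n → ℝ, (∀ p, 0 < y p) →
      ∀ p, 0 ≤ x ρ y p := fun ρ hρ y hy p =>
    div_nonneg (hy p).le (mul_pos (hrate_pos ρ hρ _ p.1.2) (hc _ p.2.2)).le
  have hy_pos : ∀ᵐ y ∂μ, ∀ p, 0 < y p := ae_all_iff.2 fun p =>
    (measurePreserving_eval (fun _ : Fin m × Fin n => expMeasure 1) p).quasiMeasurePreserving.ae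
      ae_expMeasure_pos
  have hlim : Emin k (m - l) n (fun i => r (i + l)) c = ∫ y, minAssign (m - l) n k (z y) ∂μ := by
    rw [Emin_eq_integral (fun i hi => hr _ (by omega)) hc,
      ← map_comp_pi_const (hf.prodMap Function.injective_id) (expMeasure 1)]
    have hm : Measurable fun y : Fin (m - l) × Fin n → ℝ =>
        minAssign (m - l) n k fun p => y p / (r (p.1 + l) * c p.2) :=
      (measurable_minAssign _ n k).comp (measurable_pi_lambda _ fun q => by fun_prop)
    exact integral_map (φ := fun y : Fin m × Fin n → ℝ => y ∘ Prod.map f id)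
      (measurable_pi_lambda _ fun q => measurable_pi_apply _).aemeasurable hm.aestronglyMeasurable
  have hEmin : ∀ᶠ ρ in nhdsWithin 0 {ρ : Fin l → ℝ | ∀ i, 0 < ρ i},
      ∫ y, minAssign m n k (x ρ y) ∂μ = Emin k m n (rate ρ) c := by
    filter_upwards [self_mem_nhdsWithin] with ρ hρ
    exact (Emin_eq_integral (hrate_pos ρ hρ) hc).symm
  rw [hlim]
  refine Tendsto.congr' hEmin ?_
  obtain ⟨T, hT⟩ := exists_isAssignF hkml hkn
  refine tendsto_integral_filter_of_dominated_convergence (fun y => ∑ q ∈ T, z y q) ?_ ?_ ?_ ?_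
  · exact Eventually.of_forall fun ρ =>
      ((measurable_minAssign m n k).comp (by fun_prop)).aestronglyMeasurable
  · filter_upwards [self_mem_nhdsWithin] with ρ hρ
    filter_upwards [hy_pos] with y hy
    rw [Real.norm_of_nonneg (le_minAssign hkm hkn fun S _ =>
      Finset.sum_nonneg fun p _ => hx_nn ρ hρ y hy p)]
    refine (minAssign_le_comp hkml hkn hf _).trans ?_
    rw [hxz]
    exact minAssign_le hT
  · exact integrable_finsetSum _ fun q _ =>
      (integrable_eval (i := Prod.map f id q) integrable_id_expMeasure_one).div_const _
  · filter_upwards [hy_pos] with y hy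
    have hlarge : ∀ p : Fin m × Fin n, ∀ᶠ ρ in nhdsWithin 0 {ρ : Fin l → ℝ | ∀ i, 0 < ρ i},
        p.1 ∉ Set.range f → minAssign (m - l) n k (z y) ≤ x ρ y p := by
      intro p
      by_cases hp : p.1.val < l
      · have h0 : Tendsto (fun ρ : Fin l → ℝ => rate ρ p.1 * c p.2)
            (nhdsWithin 0 {ρ | ∀ i, 0 < ρ i}) (nhdsWithin 0 (Set.Ioi 0)) := by
          refine tendsto_nhdsWithin_iff.2 ⟨?_, ?_⟩
          · have : Continuous fun ρ : Fin l → ℝ => rate ρ p.1 * c p.2 := by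
              simp only [hrate, hp, dif_pos]
              fun_prop
            refine (this.tendsto' 0 0 ?_).mono_left nhdsWithin_le_nhds
            simp [hrate, hp]
          · filter_upwards [self_mem_nhdsWithin] with ρ hρ
            exact mul_pos (hrate_pos ρ hρ _ p.1.2) (hc _ p.2.2)
        filter_upwards [((tendsto_inv_nhdsGT_zero.comp h0).const_mul_atTop
          (hy p)).eventually_ge_atTop (minAssign (m - l) n k (z y))] with ρ hρ _
        exact hρ
      · exact Eventually.of_forall fun ρ h => absurd (hrange _ h) hp
    refine tendsto_const_nhds.congr' ?_
    filter_upwards [self_mem_nhdsWithin, eventually_all.2 hlarge] with ρ hρ h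
    rw [← hxz ρ y] at h ⊢
    exact (minAssign_eq_comp hkml (Nat.sub_le m l) hkn hf (hx_nn ρ hρ y hy) h).symm
end
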